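/- arXiv:math/0609761 — 3 statements merged into one kernel-verified Lean document; each statement's English description precedes it below -/
import Mathlib

section
/- Let Z : [0,1] → ℝ be a bounded, nonnegative, nondecreasing function and define its generalized inverse v(y) = ∫₀¹ H(y − Z(a)) da for y ∈ ℝ. Then: (i) v is nondecreasing; (ii) H(y − Z(a)) = H(v(y) − a) for almost every (a,y) ∈ [0,1] × ℝ; and (iii) Z(a) = ∫₀^∞ H(a − v(y)) dy for almost every a ∈ [0,1]. -/
open MeasureTheory Set Filter Topology
open scoped ENNReal

noncomputable section

/-- The Heaviside function: `Heav s = 1` if `s > 0` and `Heav s = 0` if `s ≤ 0`. -/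
def Heav (s : ℝ) : ℝ := if 0 < s then 1 else 0

lemma integral_heav_eq_measureReal {Z : ℝ → ℝ} (hZ : Measurable Z) (y : ℝ) :
    ∫ a in Icc (0:ℝ) 1, Heav (y - Z a) =
      (volume.restrict (Icc (0:ℝ) 1)).real {a | Z a < y} := by
  have h : (fun a => Heav (y - Z a)) = {a | Z a < y}.indicator 1 := by
    ext a
    simp [Heav, indicator_apply]
  rw [h, integral_indicator_one (measurableSet_lt hZ measurable_const)]

lemma le_measureReal_of_lt {Z : ℝ → ℝ} (hmono : MonotoneOn Z (Icc (0:ℝ) 1)) {a y : ℝ}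
    (ha : a ∈ Icc (0:ℝ) 1) (h : Z a < y) :
    a ≤ (volume.restrict (Icc (0:ℝ) 1)).real {b | Z b < y} := by
  have hsub : Icc 0 a ⊆ {b | Z b < y} := fun b hb =>
    (hmono ⟨hb.1, hb.2.trans ha.2⟩ ha hb.2).trans_lt h
  have hle := measureReal_mono (μ := volume.restrict (Icc (0:ℝ) 1)) hsub
  rwa [measureReal_restrict_apply measurableSet_Icc,
    inter_eq_left.2 (Icc_subset_Icc_right ha.2), Real.volume_real_Icc_of_le ha.1, sub_zero] at hle

lemma measureReal_le_of_le {Z : ℝ → ℝ} (hZ : Measurable Z)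
    (hmono : MonotoneOn Z (Icc (0:ℝ) 1)) {a y : ℝ}
    (ha : a ∈ Icc (0:ℝ) 1) (h : y ≤ Z a) :
    (volume.restrict (Icc (0:ℝ) 1)).real {b | Z b < y} ≤ a := by
  rw [measureReal_restrict_apply (measurableSet_lt hZ measurable_const)]
  have hsub : {b | Z b < y} ∩ Icc 0 1 ⊆ Icc 0 a := by
    rintro b ⟨hb, hb01⟩
    refine ⟨hb01.1, le_of_not_gt fun hab => ?_⟩
    exact (h.trans (hmono ha hb01 hab.le)).not_gt hb
  have hle := measureReal_mono (μ := volume) hsub (by simp)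
  rwa [Real.volume_real_Icc_of_le ha.1, sub_zero] at hle

lemma setIntegral_Ioi_indicator_Iic {c : ℝ} (hc : 0 ≤ c) :
    ∫ y in Ioi (0:ℝ), (Iic c).indicator (1 : ℝ → ℝ) y = c := by
  rw [integral_indicator_one measurableSet_Iic, measureReal_restrict_apply measurableSet_Iic,
    inter_comm, Ioi_inter_Iic, Real.volume_real_Ioc_of_le hc, sub_zero]

/-- If `Z : [0,1] → ℝ` is bounded, nonnegative and nondecreasing, and
`v(y) = ∫₀¹ H(y − Z(a)) da` is its generalized inverse, then `v` is nondecreasing,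
`H(y − Z(a)) = H(v(y) − a)` for a.e. `(a,y) ∈ [0,1] × ℝ`, and
`Z(a) = ∫₀^∞ H(a − v(y)) dy` for a.e. `a ∈ [0,1]`. -/
theorem stmt0 (Z : ℝ → ℝ) (hZmeas : Measurable Z)
    (hZmono : MonotoneOn Z (Set.Icc (0:ℝ) 1))
    (hZpos : ∀ a ∈ Set.Icc (0:ℝ) 1, 0 ≤ Z a)
    (hZbdd : ∃ M : ℝ, ∀ a ∈ Set.Icc (0:ℝ) 1, Z a ≤ M)
    (v : ℝ → ℝ) (hv : ∀ y, v y = ∫ a in Set.Icc (0:ℝ) 1, Heav (y - Z a)) :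
    Monotone v ∧
    (∀ᵐ p ∂((volume.restrict (Set.Icc (0:ℝ) 1)).prod (volume : Measure ℝ)),
      Heav (p.2 - Z p.1) = Heav (v p.2 - p.1)) ∧
    (∀ᵐ a ∂(volume.restrict (Set.Icc (0:ℝ) 1)),
      Z a = ∫ y in Set.Ioi (0:ℝ), Heav (a - v y)) := by
  have hv' : ∀ y, v y = (volume.restrict (Icc (0:ℝ) 1)).real {a | Z a < y} := fun y =>
    (hv y).trans (integral_heav_eq_measureReal hZmeas y)
  have hvmono : Monotone v := by
    intro x y hxy
    rw [hv' x, hv' y]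
    exact measureReal_mono fun a (ha : Z a < x) => ha.trans_le hxy
  have hne : ∀ᵐ a ∂(volume.restrict (Icc (0:ℝ) 1)), ∀ᵐ y, a ≠ v y := by
    rw [Measure.ae_ae_comm
      (measurableSet_eq_fun measurable_fst (hvmono.measurable.comp measurable_snd)).compl]
    exact Eventually.of_forall fun y => Measure.ae_ne _ _
  have hmem : ∀ᵐ a ∂(volume.restrict (Icc (0:ℝ) 1)), a ∈ Icc (0:ℝ) 1 :=
    ae_restrict_mem measurableSet_Icc
  have hiff : ∀ a ∈ Icc (0:ℝ) 1, ∀ y, a ≠ v y → (Z a < y ↔ a < v y) := by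
    intro a ha y hay
    refine ⟨fun h => lt_of_le_of_ne ?_ hay, fun h => lt_of_not_ge fun h' => h.not_ge ?_⟩
    · exact hv' y ▸ le_measureReal_of_lt hZmono ha h
    · exact hv' y ▸ measureReal_le_of_le hZmeas hZmono ha h'
  refine ⟨hvmono, ?_, ?_⟩
  · have hHeav : Measurable Heav := Measurable.ite measurableSet_Ioi measurable_const measurable_const
    rw [Measure.ae_prod_iff_ae_ae]
    · filter_upwards [hne, hmem] with a hay ha
      filter_upwards [hay] with y hy
      simp only [Heav, sub_pos, hiff a ha y hy]
    · exact measurableSet_eq_fun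
        (hHeav.comp (measurable_snd.sub (hZmeas.comp measurable_fst)))
        (hHeav.comp ((hvmono.measurable.comp measurable_snd).sub measurable_fst))
  · filter_upwards [hne, hmem] with a hay ha
    rw [← setIntegral_Ioi_indicator_Iic (hZpos a ha)]
    refine integral_congr_ae (ae_restrict_of_ae ?_)
    filter_upwards [hay] with y hy
    have hlt : v y < a ↔ y ≤ Z a := by
      rw [← not_lt (a := Z a), hiff a ha y hy, not_lt]
      exact ⟨le_of_lt, fun h => lt_of_le_of_ne h hy.symm⟩
    simp [Heav, indicator_apply, hlt]
end
end

section
/- Let X ∈ L^∞([0,1]) be nonnegative and let Y be its increasing rearrangement. Then for every nondecreasing Z ∈ L^∞([0,1]) and every real p ≥ 1, the rearrangement inequality ∫₀¹ |Y(a) − Z(a)|^p da ≤ ∫₀¹ |X(a) − Z(a)|^p da holds. -/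
open MeasureTheory Set Filter Topology
open scoped ENNReal

noncomputable section

/-- `Y` is the increasing rearrangement (on `[0,1]`) of the nonnegative function `X`:
`Y` is nondecreasing, nonnegative, and has the same distribution as `X`, i.e.
`∫₀¹ H(y − Y(a)) da = ∫₀¹ H(y − X(a)) da` for all `y ∈ ℝ`. -/
def IsIncRearr (X Y : ℝ → ℝ) : Prop :=
  MonotoneOn Y (Set.Icc (0:ℝ) 1) ∧ (∀ a ∈ Set.Icc (0:ℝ) 1, 0 ≤ Y a) ∧
    ∀ y : ℝ, (∫ a in Set.Icc (0:ℝ) 1, Heav (y - Y a))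
      = ∫ a in Set.Icc (0:ℝ) 1, Heav (y - X a)


lemma integral_heav_sub (W : ℝ → ℝ) (hW : Measurable W) (μ : Measure ℝ) (y : ℝ) :
    ∫ a, Heav (y - W a) ∂μ = μ.real {a | W a < y} := by
  have h : (fun a => Heav (y - W a)) = {a | W a < y}.indicator (fun _ => (1 : ℝ)) := by
    funext a
    simp [Heav, Set.indicator_apply]
  rw [h, integral_indicator_const _ (measurableSet_lt hW measurable_const)]
  simp

lemma sum_range_ite_lt (f : ℕ → ℝ) {x K : ℕ} (hx : x ≤ K) :
    ∑ i ∈ Finset.range K, (if i < x then f (i + 1) - f i else 0) = f x - f 0 := by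
  rw [← Finset.sum_filter, ← Finset.sum_range_sub]
  congr 1
  ext i
  simp only [Finset.mem_filter, Finset.mem_range]
  omega

/-- Discrete Hoeffding decomposition of a function of two natural numbers. -/
lemma eq_add_sum_mixed_differences (h : ℕ → ℕ → ℝ) {x z K : ℕ} (hx : x ≤ K) (hz : z ≤ K) :
    h x z = h 0 z + ∑ i ∈ Finset.range K, (h (i + 1) 0 - h i 0) * (if i < x then 1 else 0)
      + ∑ i ∈ Finset.range K, ∑ j ∈ Finset.range K,
        (h (i + 1) (j + 1) - h i (j + 1) - (h (i + 1) j - h i j))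
          * (if i < x ∧ j < z then 1 else 0) := by
  have h1 : ∀ i, ∑ j ∈ Finset.range K,
      (h (i + 1) (j + 1) - h i (j + 1) - (h (i + 1) j - h i j))
        * (if i < x ∧ j < z then (1 : ℝ) else 0)
      = if i < x then (h (i + 1) z - h i z) - (h (i + 1) 0 - h i 0) else 0 := by
    intro i
    by_cases hi : i < x
    · simpa [hi] using sum_range_ite_lt (fun j => h (i + 1) j - h i j) hz
    · simp [hi]
  simp_rw [h1]
  have h2 := sum_range_ite_lt (fun i => h i z) hx
  have h3 : ∀ i, (h (i + 1) 0 - h i 0) * (if i < x then (1 : ℝ) else 0)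
      + (if i < x then (h (i + 1) z - h i z) - (h (i + 1) 0 - h i 0) else 0)
      = if i < x then h (i + 1) z - h i z else 0 := by
    intro i
    split_ifs <;> ring
  rw [add_assoc, ← Finset.sum_add_distrib, Finset.sum_congr rfl (fun i _ => h3 i), h2]
  ring

lemma integral_eq_add_sum_mixed_differences {α : Type*} [MeasurableSpace α] (μ : Measure α)
    [IsFiniteMeasure μ] (h : ℕ → ℕ → ℝ) {x z : α → ℕ} (hx : Measurable x) (hz : Measurable z)
    {K : ℕ} (hxK : ∀ᵐ a ∂μ, x a ≤ K) (hzK : ∀ᵐ a ∂μ, z a ≤ K) :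
    ∫ a, h (x a) (z a) ∂μ = ∫ a, h 0 (z a) ∂μ
      + ∑ i ∈ Finset.range K, (h (i + 1) 0 - h i 0) * μ.real {a | i < x a}
      + ∑ i ∈ Finset.range K, ∑ j ∈ Finset.range K,
        (h (i + 1) (j + 1) - h i (j + 1) - (h (i + 1) j - h i j))
          * μ.real {a | i < x a ∧ j < z a} := by
  have hmx : ∀ i, MeasurableSet {a | i < x a} := fun i => measurableSet_lt measurable_const hx
  have hmz : ∀ i, MeasurableSet {a | i < z a} := fun i => measurableSet_lt measurable_const hz
  have hmxz : ∀ i j, MeasurableSet {a | i < x a ∧ j < z a} := fun i j => (hmx i).inter (hmz j)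
  have hi : ∀ s : Set α, MeasurableSet s → ∀ c : ℝ,
      Integrable (fun a => c * s.indicator (fun _ => (1 : ℝ)) a) μ := fun s hs c =>
    ((integrable_const (1 : ℝ)).indicator hs).const_mul c
  have hI : ∀ s : Set α, MeasurableSet s → ∀ c : ℝ,
      ∫ a, c * s.indicator (fun _ => (1 : ℝ)) a ∂μ = c * μ.real s := fun s hs c => by
    rw [integral_const_mul, integral_indicator_const _ hs]
    simp
  have hz0 : Integrable (fun a => h 0 (z a)) μ := by
    refine Integrable.of_bound
      ((measurable_from_nat (f := h 0)).comp hz).aestronglyMeasurable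
      (∑ j ∈ Finset.range (K + 1), ‖h 0 j‖) ?_
    filter_upwards [hzK] with a ha
    exact Finset.single_le_sum (f := fun j => ‖h 0 j‖) (fun _ _ => norm_nonneg _)
      (Finset.mem_range.2 (Nat.lt_succ_of_le ha))
  have hae : ∀ᵐ a ∂μ, h (x a) (z a) = h 0 (z a)
      + ∑ i ∈ Finset.range K, (h (i + 1) 0 - h i 0)
          * {a | i < x a}.indicator (fun _ => (1 : ℝ)) a
      + ∑ i ∈ Finset.range K, ∑ j ∈ Finset.range K,
        (h (i + 1) (j + 1) - h i (j + 1) - (h (i + 1) j - h i j))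
          * {a | i < x a ∧ j < z a}.indicator (fun _ => (1 : ℝ)) a := by
    filter_upwards [hxK, hzK] with a h1 h2
    simpa only [Set.indicator_apply, Set.mem_ofPred_eq] using
      eq_add_sum_mixed_differences h h1 h2
  have hS1 := integrable_finsetSum (μ := μ) (Finset.range K) fun i _ =>
    hi _ (hmx i) (h (i + 1) 0 - h i 0)
  have hS2 := integrable_finsetSum (μ := μ) (Finset.range K) fun i _ =>
    integrable_finsetSum (Finset.range K) fun j _ =>
      hi _ (hmxz i j) (h (i + 1) (j + 1) - h i (j + 1) - (h (i + 1) j - h i j))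
  have hS0 : Integrable (fun a => h 0 (z a) + ∑ i ∈ Finset.range K, (h (i + 1) 0 - h i 0)
      * {a | i < x a}.indicator (fun _ => (1 : ℝ)) a) μ := hz0.add hS1
  rw [integral_congr_ae hae, integral_add hS0 hS2, integral_add hz0 hS1,
    integral_finsetSum _ fun i _ => hi _ (hmx i) _,
    integral_finsetSum _ fun i _ =>
      integrable_finsetSum _ fun j _ => hi _ (hmxz i j) _]
  congr 1
  · congr 1
    exact Finset.sum_congr rfl fun i _ => hI _ (hmx i) _
  · refine Finset.sum_congr rfl fun i _ => ?_
    rw [integral_finsetSum _ fun j _ => hi _ (hmxz i j) _]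
    exact Finset.sum_congr rfl fun j _ => hI _ (hmxz i j) _

/-- A submodular cost decreases when equally distributed `x` is replaced by a `y` whose joint
upper tails with `z` are larger. -/
lemma integral_le_integral_of_submodular {α : Type*} [MeasurableSpace α] (μ : Measure α)
    [IsFiniteMeasure μ] (h : ℕ → ℕ → ℝ)
    (hsub : ∀ i j, h (i + 1) (j + 1) + h i j ≤ h (i + 1) j + h i (j + 1))
    {x y z : α → ℕ} (hx : Measurable x) (hy : Measurable y) (hz : Measurable z)
    {K : ℕ} (hxK : ∀ᵐ a ∂μ, x a ≤ K) (hyK : ∀ᵐ a ∂μ, y a ≤ K) (hzK : ∀ᵐ a ∂μ, z a ≤ K)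
    (hxy : ∀ i, μ.real {a | i < y a} = μ.real {a | i < x a})
    (hxyz : ∀ i j, μ.real {a | i < x a ∧ j < z a} ≤ μ.real {a | i < y a ∧ j < z a}) :
    ∫ a, h (y a) (z a) ∂μ ≤ ∫ a, h (x a) (z a) ∂μ := by
  rw [integral_eq_add_sum_mixed_differences μ h hx hz hxK hzK,
    integral_eq_add_sum_mixed_differences μ h hy hz hyK hzK]
  simp_rw [hxy]
  refine add_le_add_right (Finset.sum_le_sum fun i _ => Finset.sum_le_sum fun j _ => ?_) _
  exact mul_le_mul_of_nonpos_left (hxyz i j) (by linarith [hsub i j])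

lemma abs_rpow_midpoint_le {p : ℝ} (hp : 1 ≤ p) (u d : ℝ) :
    |u| ^ p + |u| ^ p ≤ |u + d| ^ p + |u - d| ^ p := by
  have h := (convexOn_rpow hp).2 (abs_nonneg (u + d)) (abs_nonneg (u - d))
    (by norm_num : (0 : ℝ) ≤ 1 / 2) (by norm_num : (0 : ℝ) ≤ 1 / 2) (by norm_num)
  simp only [smul_eq_mul] at h
  have h1 : |u| ≤ 1 / 2 * |u + d| + 1 / 2 * |u - d| := by
    have := abs_add_le (u + d) (u - d)
    rw [show u + d + (u - d) = 2 * u by ring, abs_mul, abs_two] at this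
    linarith
  have h2 := Real.rpow_le_rpow (abs_nonneg u) h1 (by linarith : 0 ≤ p)
  linarith

lemma measureReal_inter_le_of_monotoneOn {μ : Measure ℝ} [IsFiniteMeasure μ] {I : Set ℝ}
    (hI : ∀ᵐ a ∂μ, a ∈ I) {Y Z : ℝ → ℝ} (hY : MonotoneOn Y I) (hZ : MonotoneOn Z I)
    (A : Set ℝ) (s t : ℝ) (hA : μ.real A = μ.real {a | s ≤ Y a}) :
    μ.real (A ∩ {a | t ≤ Z a}) ≤ μ.real ({a | s ≤ Y a} ∩ {a | t ≤ Z a}) := by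
  by_cases hc : ∀ a ∈ I, s ≤ Y a → t ≤ Z a
  · calc μ.real (A ∩ {a | t ≤ Z a}) ≤ μ.real A := measureReal_mono inter_subset_left
      _ = μ.real ({a | s ≤ Y a} ∩ {a | t ≤ Z a}) := by
        rw [hA]
        refine measureReal_congr ?_
        filter_upwards [hI] with a ha
        exact propext ⟨fun h => ⟨h, hc a ha h⟩, fun h => h.1⟩
  · push Not at hc
    obtain ⟨b, hb, hbY, hbZ⟩ := hc
    calc μ.real (A ∩ {a | t ≤ Z a}) ≤ μ.real {a | t ≤ Z a} := measureReal_mono inter_subset_right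
      _ = μ.real ({a | s ≤ Y a} ∩ {a | t ≤ Z a}) := by
        refine measureReal_congr ?_
        filter_upwards [hI] with a ha
        refine propext ⟨fun h => ⟨?_, h⟩, fun h => h.2⟩
        have hab : b ≤ a := by
          by_contra! hab
          exact absurd (hZ ha hb hab.le) (not_le.2 (hbZ.trans_le h))
        exact hbY.trans (hY hb ha hab)

lemma floor_mul_div_le {n : ℕ} {x : ℝ} (hx : 0 ≤ x) : (⌊x * n⌋₊ : ℝ) / n ≤ x := by
  rcases Nat.eq_zero_or_pos n with rfl | hn
  · simpa using hx
  · rw [div_le_iff₀ (by exact_mod_cast hn)]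
    exact Nat.floor_le (by positivity)

lemma tendsto_floor_mul_div {x : ℝ} (hx : 0 ≤ x) :
    Tendsto (fun n : ℕ => (⌊x * n⌋₊ : ℝ) / n) atTop (𝓝 x) :=
  (tendsto_nat_floor_mul_div_atTop hx).comp tendsto_natCast_atTop_atTop

lemma lt_floor_mul_iff {n : ℕ} (hn : 0 < n) (i : ℕ) (x : ℝ) :
    i < ⌊x * n⌋₊ ↔ ((i + 1 : ℕ) : ℝ) / n ≤ x := by
  rw [← Nat.succ_le_iff, Nat.le_floor_iff' (Nat.succ_ne_zero i),
    div_le_iff₀ (by exact_mod_cast hn)]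

lemma tendsto_integral_discretization {μ : Measure ℝ} [IsFiniteMeasure μ] {W Z : ℝ → ℝ}
    (hW : Measurable W) (hZ : Measurable Z) {M c D p : ℝ} (hp : 0 < p)
    (hWM : ∀ᵐ a ∂μ, 0 ≤ W a ∧ W a ≤ M) (hZD : ∀ᵐ a ∂μ, c ≤ Z a ∧ Z a ≤ D) :
    Tendsto (fun n : ℕ => ∫ a, |(⌊W a * n⌋₊ : ℝ) / n - (⌊(Z a - c) * n⌋₊ : ℝ) / n - c| ^ p ∂μ)
      atTop (𝓝 (∫ a, |W a - Z a| ^ p ∂μ)) := by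
  refine tendsto_integral_of_dominated_convergence (fun _ => (M + (D - c) + |c|) ^ p)
    (fun n => ?_) (integrable_const _) (fun n => ?_) ?_
  · refine Measurable.aestronglyMeasurable ?_
    have h1 : Measurable fun a => (⌊W a * n⌋₊ : ℝ) :=
      measurable_from_nat.comp (Nat.measurable_floor.comp (hW.mul_const _))
    have h2 : Measurable fun a => (⌊(Z a - c) * n⌋₊ : ℝ) :=
      measurable_from_nat.comp (Nat.measurable_floor.comp ((hZ.sub_const c).mul_const _))
    have h3 := ((h1.div_const (n : ℝ)).sub (h2.div_const (n : ℝ))).sub_const c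
    exact (continuous_abs.measurable.comp h3).pow_const p
  · filter_upwards [hWM, hZD] with a h1 h2
    rw [Real.norm_of_nonneg (by positivity)]
    refine Real.rpow_le_rpow (abs_nonneg _) ?_ hp.le
    have h3 := floor_mul_div_le (n := n) h1.1
    have h4 := floor_mul_div_le (n := n) (sub_nonneg.2 h2.1)
    have h5 : 0 ≤ (⌊W a * n⌋₊ : ℝ) / n := by positivity
    have h6 : 0 ≤ (⌊(Z a - c) * n⌋₊ : ℝ) / n := by positivity
    rw [abs_le]
    constructor <;> linarith [neg_abs_le c, le_abs_self c, h1.2, h2.2]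
  · filter_upwards [hWM, hZD] with a h1 h2
    have h3 := ((tendsto_floor_mul_div h1.1).sub
      (tendsto_floor_mul_div (sub_nonneg.2 h2.1))).sub_const c
    rw [show W a - (Z a - c) - c = W a - Z a by ring] at h3
    exact h3.abs.rpow_const (Or.inr hp.le)

/-- **rearrangement inequality.** If `Y` is the increasing rearrangement
of a nonnegative `X ∈ L^∞([0,1])`, then for every nondecreasing `Z ∈ L^∞([0,1])` and
every real `p ≥ 1`: `∫₀¹ |Y − Z|^p da ≤ ∫₀¹ |X − Z|^p da`. -/
theorem stmt3 (X : ℝ → ℝ) (hXmeas : Measurable X)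
    (hXpos : ∀ᵐ a ∂(volume.restrict (Set.Icc (0:ℝ) 1)), 0 ≤ X a)
    (hXbdd : ∃ M : ℝ, ∀ᵐ a ∂(volume.restrict (Set.Icc (0:ℝ) 1)), |X a| ≤ M)
    (Y : ℝ → ℝ) (hYmeas : Measurable Y)
    (hYbdd : ∃ M : ℝ, ∀ a ∈ Set.Icc (0:ℝ) 1, Y a ≤ M)
    (hY : IsIncRearr X Y)
    (Z : ℝ → ℝ) (hZmeas : Measurable Z) (hZmono : MonotoneOn Z (Set.Icc (0:ℝ) 1))
    (hZbdd : ∃ M : ℝ, ∀ᵐ a ∂(volume.restrict (Set.Icc (0:ℝ) 1)), |Z a| ≤ M)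
    (p : ℝ) (hp : 1 ≤ p) :
    (∫ a in Set.Icc (0:ℝ) 1, |Y a - Z a| ^ p)
      ≤ ∫ a in Set.Icc (0:ℝ) 1, |X a - Z a| ^ p := by
  obtain ⟨hYmono, hYpos, hYdist⟩ := hY
  obtain ⟨M₁, hM₁⟩ := hXbdd
  obtain ⟨M₂, hM₂⟩ := hYbdd
  set μ : Measure ℝ := volume.restrict (Set.Icc (0 : ℝ) 1)
  set M := max M₁ M₂
  have hI : ∀ᵐ a ∂μ, a ∈ Set.Icc (0 : ℝ) 1 := ae_restrict_mem measurableSet_Icc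
  have hXM : ∀ᵐ a ∂μ, 0 ≤ X a ∧ X a ≤ M := by
    filter_upwards [hXpos, hM₁] with a h1 h2
    exact ⟨h1, (le_abs_self _).trans (h2.trans (le_max_left _ _))⟩
  have hYM : ∀ᵐ a ∂μ, 0 ≤ Y a ∧ Y a ≤ M := by
    filter_upwards [hI] with a ha
    exact ⟨hYpos a ha, (hM₂ a ha).trans (le_max_right _ _)⟩
  have h0 : (0 : ℝ) ∈ Set.Icc (0 : ℝ) 1 := by simp
  have h1 : (1 : ℝ) ∈ Set.Icc (0 : ℝ) 1 := by simp
  have hZD : ∀ᵐ a ∂μ, Z 0 ≤ Z a ∧ Z a ≤ Z 1 := by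
    filter_upwards [hI] with a ha
    exact ⟨hZmono h0 ha ha.1, hZmono ha h1 ha.2⟩
  have hp0 : 0 < p := by linarith
  have hdist : ∀ y, μ.real {a | y ≤ Y a} = μ.real {a | y ≤ X a} := by
    intro y
    have h := hYdist y
    rw [integral_heav_sub Y hYmeas, integral_heav_sub X hXmeas] at h
    have hc : ∀ W : ℝ → ℝ, {a | y ≤ W a} = {a | W a < y}ᶜ := fun W => by
      ext a
      simp
    rw [hc Y, hc X, measureReal_compl (measurableSet_lt hYmeas measurable_const),
      measureReal_compl (measurableSet_lt hXmeas measurable_const), h]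
  refine le_of_tendsto_of_tendsto (tendsto_integral_discretization hYmeas hZmeas hp0 hYM hZD)
    (tendsto_integral_discretization hXmeas hZmeas hp0 hXM hZD) ?_
  filter_upwards [eventually_gt_atTop 0] with n hn
  have hfloor : ∀ {W : ℝ → ℝ}, Measurable W → Measurable fun a => ⌊W a * n⌋₊ := fun hW =>
    Nat.measurable_floor.comp (hW.mul_const _)
  have hle : ∀ {w B : ℝ}, w ≤ B → ⌊w * n⌋₊ ≤ ⌊B * n⌋₊ := fun h =>
    Nat.floor_mono (mul_le_mul_of_nonneg_right h (Nat.cast_nonneg n))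
  refine integral_le_integral_of_submodular μ
    (fun i j => |(i : ℝ) / n - (j : ℝ) / n - Z 0| ^ p) (fun i j => ?_)
    (hfloor hXmeas) (hfloor hYmeas) (hfloor (hZmeas.sub_const (Z 0)))
    (K := max ⌊M * n⌋₊ ⌊(Z 1 - Z 0) * n⌋₊) ?_ ?_ ?_ (fun i => ?_) (fun i j => ?_)
  · have h := abs_rpow_midpoint_le hp ((i : ℝ) / n - (j : ℝ) / n - Z 0) (1 / n)
    convert h using 3 <;> congr 1 <;> push_cast <;> ring
  · filter_upwards [hXM] with a ha
    exact (hle ha.2).trans (le_max_left _ _)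
  · filter_upwards [hYM] with a ha
    exact (hle ha.2).trans (le_max_left _ _)
  · filter_upwards [hZD] with a ha
    exact (hle (sub_le_sub_right ha.2 _)).trans (le_max_right _ _)
  · simp_rw [lt_floor_mul_iff hn]
    exact hdist _
  · simp_rw [lt_floor_mul_iff hn]
    exact measureReal_inter_le_of_monotoneOn hI hYmono
      (fun a ha b hb hab => sub_le_sub_right (hZmono ha hb hab) (Z 0)) _ _ _ (hdist _).symm
end
end

section
/- Let p ≥ 1 and let μ, ν be compactly supported Borel probability measures on [0,∞) ⊂ ℝ. Let u(y) = μ((−∞,y]) and v(y) = ν((−∞,y]) be their cumulative distribution functions, and let Y(a) = ∫₀^∞ H(a − u(y)) dy and Z(a) = ∫₀^∞ H(a − v(y)) dy, a ∈ [0,1], be the generalized inverses of u and v. Then the p-th Monge–Kantorovich distance satisfies δ_p^p(μ,ν) = ∫₀¹ |Y(a) − Z(a)|^p da, where δ_p^p(μ,ν) = sup{ ∫φ dμ + ∫ψ dν : φ, ψ continuous on ℝ with φ(x) + ψ(y) ≤ |x − y|^p for all x, y ∈ ℝ }. -/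
open MeasureTheory Set Filter Topology
open scoped ENNReal

noncomputable section

/-- The `p`-th power `δ_p^p(μ,ν)` of the `p`-th Monge–Kantorovich distance, via the
dual formulation: the supremum of `∫φ dμ + ∫ψ dν` over continuous `φ, ψ` with
`φ(x) + ψ(y) ≤ |x − y|^p` for all `x, y`. -/
def MKdist (p : ℝ) (μ ν : Measure ℝ) : ℝ :=
  sSup {r : ℝ | ∃ φ ψ : ℝ → ℝ, Continuous φ ∧ Continuous ψ ∧
    (∀ x y : ℝ, φ x + ψ y ≤ |x - y| ^ p) ∧ r = (∫ x, φ x ∂μ) + ∫ y, ψ y ∂ν}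

open ProbabilityTheory

/-- The generalized inverse of the cumulative distribution function of `μ`. -/
def quantile (μ : Measure ℝ) (a : ℝ) : ℝ := ∫ y in Ioi (0:ℝ), Heav (a - cdf μ y)

lemma quantile_eq_measureReal (μ : Measure ℝ) (a : ℝ) :
    quantile μ a = volume.real (Ioi 0 ∩ {y | cdf μ y < a}) := by
  have hm : MeasurableSet {y | cdf μ y < a} :=
    measurableSet_lt (cdf μ).mono.measurable measurable_const
  have h : (fun y => Heav (a - cdf μ y)) = {y | cdf μ y < a}.indicator 1 := by
    ext y
    simp [Heav, indicator, sub_pos]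
  rw [quantile, h, integral_indicator_one hm, measureReal_restrict_apply hm, inter_comm]

lemma quantile_nonneg (μ : Measure ℝ) (a : ℝ) : 0 ≤ quantile μ a := by
  rw [quantile_eq_measureReal]
  exact measureReal_nonneg

lemma quantile_zero (μ : Measure ℝ) : quantile μ 0 = 0 := by
  have h : {y | cdf μ y < 0} = ∅ :=
    eq_empty_of_forall_notMem fun y hy => (cdf_nonneg μ y).not_gt hy
  rw [quantile_eq_measureReal, h, inter_empty, measureReal_empty]

lemma nonneg_of_Icc {μ : Measure ℝ} {R : ℝ} (hR : μ (Icc 0 R) = 1) : 0 ≤ R := by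
  by_contra h
  simp [Icc_eq_empty h] at hR

section

variable {μ : Measure ℝ} [IsProbabilityMeasure μ] {R : ℝ}

lemma cdf_eq_one_of_Icc (hR : μ (Icc 0 R) = 1) : cdf μ R = 1 := by
  rw [cdf_eq_real, measureReal_def, prob_le_one.antisymm (hR ▸ measure_mono Icc_subset_Iic_self),
    ENNReal.toReal_one]

lemma cdf_eq_zero_of_Icc (hR : μ (Icc 0 R) = 1) {x : ℝ} (hx : x < 0) : cdf μ x = 0 := by
  have h0 : μ (Icc 0 R)ᶜ = 0 := (prob_compl_eq_zero_iff measurableSet_Icc).2 hR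
  have h1 : μ (Iic x) = 0 := measure_mono_null (t := (Icc 0 R)ᶜ)
    (fun y (hy : y ≤ x) h => hx.not_ge (h.1.trans hy)) h0
  rw [cdf_eq_real, measureReal_def, h1, ENNReal.toReal_zero]

/-- The quantile function is the lower adjoint of the cumulative distribution function. -/
lemma quantile_le_iff (hR : μ (Icc 0 R) = 1) {a : ℝ} (ha : a ∈ Ioc (0:ℝ) 1) (x : ℝ) :
    quantile μ a ≤ x ↔ a ≤ cdf μ x := by
  rcases lt_or_ge x 0 with hx | hx
  · rw [cdf_eq_zero_of_Icc hR hx]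
    exact iff_of_false (by linarith [quantile_nonneg μ a]) (by linarith [ha.1])
  have hsub : ∀ z, a ≤ cdf μ z → Ioi 0 ∩ {y | cdf μ y < a} ⊆ Ioc 0 z := fun z hz y hy =>
    ⟨hy.1, le_of_lt <| lt_of_not_ge fun hzy => hy.2.not_ge (hz.trans ((cdf μ).mono hzy))⟩
  rw [quantile_eq_measureReal]
  constructor
  · intro h
    by_contra! hlt
    have hev : ∀ᶠ y in 𝓝[≥] x, cdf μ y < a :=
      ((cdf μ).right_continuous x).eventually (gt_mem_nhds hlt)
    obtain ⟨z, hxz, hz⟩ := (mem_nhdsGE_iff_exists_Icc_subset).1 hev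
    have hsup : Ioc 0 z ⊆ Ioi 0 ∩ {y | cdf μ y < a} := fun y hy =>
      ⟨hy.1, ((cdf μ).mono hy.2).trans_lt (hz ⟨le_of_lt hxz, le_rfl⟩)⟩
    have hfin : volume (Ioi 0 ∩ {y | cdf μ y < a}) ≠ ∞ :=
      measure_ne_top_of_subset (hsub R (by rw [cdf_eq_one_of_Icc hR]; exact ha.2))
        measure_Ioc_lt_top.ne
    have := measureReal_mono hsup hfin
    rw [Real.volume_real_Ioc_of_le (hx.trans (le_of_lt hxz))] at this
    have hxz' : x < z := hxz
    linarith
  · intro h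
    have := measureReal_mono (μ := volume) (hsub x h) measure_Ioc_lt_top.ne
    rwa [Real.volume_real_Ioc_of_le hx, sub_zero] at this

lemma quantile_monotoneOn (hR : μ (Icc 0 R) = 1) : MonotoneOn (quantile μ) (Icc 0 1) := by
  intro a ha b hb hab
  rcases ha.1.eq_or_lt with rfl | h0
  · rw [quantile_zero]
    exact quantile_nonneg μ b
  · rw [quantile_le_iff hR ⟨h0, ha.2⟩]
    exact hab.trans ((quantile_le_iff hR ⟨h0.trans_le hab, hb.2⟩ _).1 le_rfl)

lemma quantile_mem_Icc (hR : μ (Icc 0 R) = 1) {a : ℝ} (ha : a ∈ Icc (0:ℝ) 1) :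
    quantile μ a ∈ Icc 0 R := by
  refine ⟨quantile_nonneg μ a, ?_⟩
  rcases ha.1.eq_or_lt with rfl | h0
  · rw [quantile_zero]
    exact nonneg_of_Icc hR
  · rw [quantile_le_iff hR ⟨h0, ha.2⟩, cdf_eq_one_of_Icc hR]
    exact ha.2

lemma aemeasurable_quantile (hR : μ (Icc 0 R) = 1) :
    AEMeasurable (quantile μ) (volume.restrict (Ioc 0 1)) :=
  aemeasurable_restrict_of_monotoneOn measurableSet_Ioc
    ((quantile_monotoneOn hR).mono Ioc_subset_Icc_self)

/-- The quantile function pushes Lebesgue measure on the unit interval forward to `μ`. -/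
lemma map_quantile (hR : μ (Icc 0 R) = 1) :
    Measure.map (quantile μ) (volume.restrict (Ioc 0 1)) = μ := by
  refine Measure.ext_of_Iic _ _ fun x => ?_
  rw [Measure.map_apply_of_aemeasurable (aemeasurable_quantile hR) measurableSet_Iic,
    Measure.restrict_apply' measurableSet_Ioc]
  have h : quantile μ ⁻¹' Iic x ∩ Ioc 0 1 = Ioc 0 (cdf μ x) := by
    ext a
    constructor
    · rintro ⟨h, ha⟩
      exact ⟨ha.1, (quantile_le_iff hR ha x).1 h⟩
    · intro h
      have ha : a ∈ Ioc (0:ℝ) 1 := ⟨h.1, h.2.trans (cdf_le_one μ x)⟩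
      exact ⟨(quantile_le_iff hR ha x).2 h.2, ha⟩
  rw [h, Real.volume_Ioc, sub_zero, cdf_eq_real, ofReal_measureReal]

lemma integral_eq_integral_quantile (hR : μ (Icc 0 R) = 1) {φ : ℝ → ℝ} (hφ : Continuous φ) :
    ∫ x, φ x ∂μ = ∫ a in Ioc (0:ℝ) 1, φ (quantile μ a) := by
  conv_lhs => rw [← map_quantile hR]
  exact integral_map (aemeasurable_quantile hR) hφ.aestronglyMeasurable

lemma integrableOn_comp_quantile {ν : Measure ℝ} [IsProbabilityMeasure ν] {S : ℝ}
    (hR : μ (Icc 0 R) = 1) (hS : ν (Icc 0 S) = 1) {f : ℝ × ℝ → ℝ} (hf : Continuous f) :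
    IntegrableOn (fun a => f (quantile μ a, quantile ν a)) (Ioc 0 1) := by
  obtain ⟨C, hC⟩ := (isCompact_Icc (a := (0:ℝ)) (b := R)).prod
    (isCompact_Icc (a := (0:ℝ)) (b := S)) |>.exists_bound_of_continuousOn hf.continuousOn
  refine Integrable.of_bound
    (hf.measurable.comp_aemeasurable
      ((aemeasurable_quantile hR).prodMk (aemeasurable_quantile hS))).aestronglyMeasurable C ?_
  filter_upwards [ae_restrict_mem measurableSet_Ioc] with a ha
  exact hC _ ⟨quantile_mem_Icc hR (Ioc_subset_Icc_self ha),
    quantile_mem_Icc hS (Ioc_subset_Icc_self ha)⟩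

end

lemma continuous_abs_rpow {p : ℝ} (hp : 1 ≤ p) : Continuous fun t : ℝ => |t| ^ p :=
  continuous_abs.rpow_const fun _ => Or.inr (by linarith)

lemma hasDerivAt_abs_rpow_of_ne_zero (p : ℝ) {t : ℝ} (ht : t ≠ 0) :
    HasDerivAt (fun s : ℝ => |s| ^ p) (SignType.sign t * (p * |t| ^ (p - 1))) t := by
  convert (hasDerivAt_abs ht).rpow_const (p := p) (Or.inl (abs_ne_zero.2 ht)) using 1
  ring

lemma monotone_sign_mul_abs_rpow {p : ℝ} (hp : 1 ≤ p) :
    Monotone fun t : ℝ => SignType.sign t * (p * |t| ^ (p - 1)) := by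
  have hnn : ∀ t : ℝ, 0 ≤ p * |t| ^ (p - 1) := fun t => by positivity
  intro s t hst
  rcases lt_trichotomy s 0 with hs | rfl | hs
  · rcases lt_trichotomy t 0 with ht | rfl | ht
    · have : |t| ^ (p - 1) ≤ |s| ^ (p - 1) :=
        Real.rpow_le_rpow (abs_nonneg t) (by rw [abs_of_neg hs, abs_of_neg ht]; linarith)
          (by linarith)
      simp only [sign_neg hs, sign_neg ht, SignType.coe_neg, SignType.coe_one, neg_one_mul]
      nlinarith
    · simpa [sign_neg hs] using hnn s
    · simp only [sign_neg hs, sign_pos ht, SignType.coe_neg, SignType.coe_one, neg_one_mul, one_mul]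
      linarith [hnn s, hnn t]
  · rcases hst.eq_or_lt with rfl | ht
    · exact le_rfl
    · simpa [sign_pos ht] using hnn t
  · have ht := hs.trans_le hst
    have : |s| ^ (p - 1) ≤ |t| ^ (p - 1) :=
      Real.rpow_le_rpow (abs_nonneg s) (by rwa [abs_of_pos hs, abs_of_pos ht]) (by linarith)
    simp only [sign_pos hs, sign_pos ht, SignType.coe_one, one_mul]
    nlinarith

lemma integral_sign_mul_abs_rpow {p : ℝ} (hp : 1 ≤ p) (x y z : ℝ) :
    ∫ s in x..y, SignType.sign (s - z) * (p * |s - z| ^ (p - 1)) = |y - z| ^ p - |x - z| ^ p := by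
  have h := intervalIntegral.integral_comp_sub_right (a := x) (b := y)
    (fun t : ℝ => SignType.sign t * (p * |t| ^ (p - 1))) z
  rw [h]
  exact integral_eq_of_hasDerivAt_off_countable (fun t : ℝ => |t| ^ p) _ (countable_singleton 0)
    (continuous_abs_rpow hp).continuousOn (fun t ht => hasDerivAt_abs_rpow_of_ne_zero p ht.2)
    (monotone_sign_mul_abs_rpow hp).intervalIntegrable

/-- For a monotone map `T`, there is a Kantorovich potential on `ℝ` with the following property:
wherever `T` crosses the value `z` at `y`, the cost to `z` minus the potential is minimal at `y`. -/
lemma exists_potential {p : ℝ} (hp : 1 ≤ p) {T : ℝ → ℝ} (hT : Monotone T) :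
    ∃ φ : ℝ → ℝ, Continuous φ ∧ ∀ y z, (∀ s < y, T s ≤ z) → (∀ s, y ≤ s → z ≤ T s) →
      ∀ x, |y - z| ^ p - φ y ≤ |x - z| ^ p - φ x := by
  set d : ℝ → ℝ := fun t => SignType.sign t * (p * |t| ^ (p - 1)) with hd
  have hdm : Monotone d := monotone_sign_mul_abs_rpow hp
  have hint : ∀ x y, IntervalIntegrable (fun s => d (s - T s)) volume x y := by
    intro x y
    have hm : Measurable fun s => d (s - T s) :=
      hdm.measurable.comp (measurable_id.sub hT.measurable)
    have hb : ∀ s ∈ uIcc x y, s - T s ∈ Icc (x ⊓ y - T (x ⊔ y)) (x ⊔ y - T (x ⊓ y)) :=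
      fun s hs => ⟨sub_le_sub hs.1 (hT hs.2), sub_le_sub hs.2 (hT hs.1)⟩
    rw [intervalIntegrable_iff]
    refine Measure.integrableOn_of_bounded
      (M := max |d (x ⊓ y - T (x ⊔ y))| |d (x ⊔ y - T (x ⊓ y))|) (by simp [uIoc])
      hm.aestronglyMeasurable ?_
    filter_upwards [ae_restrict_mem measurableSet_uIoc] with s hs
    have := hb s (uIoc_subset_uIcc hs)
    exact abs_le_max_abs_abs (hdm this.1) (hdm this.2)
  have hint' : ∀ x y z, IntervalIntegrable (fun s => d (s - z)) volume x y := fun x y z =>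
    Monotone.intervalIntegrable fun s t hst => hdm (sub_le_sub_right hst z)
  refine ⟨fun x => ∫ s in (0:ℝ)..x, d (s - T s),
    intervalIntegral.continuous_primitive hint 0, fun y z h1 h2 x => ?_⟩
  have e1 := intervalIntegral.integral_interval_sub_left (hint 0 x) (hint 0 y)
  have e2 := integral_sign_mul_abs_rpow hp y x z
  rcases le_total y x with hyx | hxy
  · have := intervalIntegral.integral_mono_on hyx (hint y x) (hint' y x z) fun s hs =>
      hdm (sub_le_sub_left (h2 s hs.1) s)
    simp only [hd] at *
    linarith
  · have := intervalIntegral.integral_mono_on_of_le_Ioo hxy (hint' x y z) (hint x y) fun s hs =>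
      hdm (sub_le_sub_left (h1 s hs.2) s)
    rw [intervalIntegral.integral_symm x y] at e1 e2
    simp only [hd] at *
    linarith

/-- There is a dual pair that is tight along the monotone coupling. -/
lemma exists_dual_pair {p : ℝ} (hp : 1 ≤ p) {μ ν : Measure ℝ} [IsProbabilityMeasure μ]
    [IsProbabilityMeasure ν] {R S : ℝ} (hR : μ (Icc 0 R) = 1) (hS : ν (Icc 0 S) = 1) :
    ∃ φ ψ : ℝ → ℝ, Continuous φ ∧ Continuous ψ ∧ (∀ x y, φ x + ψ y ≤ |x - y| ^ p) ∧
      ∀ a ∈ Ioc (0:ℝ) 1, φ (quantile μ a) + ψ (quantile ν a) =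
        |quantile μ a - quantile ν a| ^ p := by
  have hcdf : ∀ s, cdf μ s ∈ Icc (0:ℝ) 1 := fun s => ⟨cdf_nonneg μ s, cdf_le_one μ s⟩
  have hT : Monotone fun s => quantile ν (cdf μ s) := fun s t hst =>
    quantile_monotoneOn hS (hcdf s) (hcdf t) ((cdf μ).mono hst)
  obtain ⟨φ, hφ, hmin⟩ := exists_potential hp hT
  set M := max R S
  have hM : (0:ℝ) ≤ M := (nonneg_of_Icc hR).trans (le_max_left _ _)
  set π : ℝ → ℝ := fun x => projIcc 0 M hM x with hπ
  have hπc : Continuous π := continuous_subtype_val.comp continuous_projIcc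
  have hπm : ∀ x, π x ∈ Icc 0 M := fun x => (projIcc 0 M hM x).2
  have hπid : ∀ x ∈ Icc 0 M, π x = x := fun x hx => by simp [hπ, projIcc_of_mem hM hx]
  have hg : Continuous fun q : ℝ × ℝ => |q.2 - q.1| ^ p - φ q.2 :=
    ((continuous_abs_rpow hp).comp (continuous_snd.sub continuous_fst)).sub (hφ.comp continuous_snd)
  have hgy : ∀ y, Continuous fun x => |x - y| ^ p - φ x := fun y =>
    hg.comp (continuous_const.prodMk continuous_id)
  set ψ : ℝ → ℝ := fun y => sInf ((fun x => |x - y| ^ p - φ x) '' Icc 0 M)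
  have hψ : Continuous ψ :=
    IsCompact.continuous_sInf (f := fun y x => |x - y| ^ p - φ x) isCompact_Icc hg
  have hψle : ∀ x ∈ Icc 0 M, ∀ y, ψ y ≤ |x - y| ^ p - φ x := fun x hx y =>
    csInf_le (isCompact_Icc.image (hgy y)).bddBelow (mem_image_of_mem _ hx)
  refine ⟨φ ∘ π, ψ ∘ π, hφ.comp hπc, hψ.comp hπc, fun x y => ?_, fun a ha => ?_⟩
  · have h1 := hψle (π x) (hπm x) (π y)
    have h2 : |π x - π y| ^ p ≤ |x - y| ^ p :=
      Real.rpow_le_rpow (abs_nonneg _) (abs_projIcc_sub_projIcc hM) (by linarith)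
    simp only [Function.comp]
    linarith
  · have ha' := Ioc_subset_Icc_self ha
    have hYm : quantile μ a ∈ Icc 0 M :=
      Icc_subset_Icc_right (le_max_left R S) (quantile_mem_Icc hR ha')
    have hZm : quantile ν a ∈ Icc 0 M :=
      Icc_subset_Icc_right (le_max_right R S) (quantile_mem_Icc hS ha')
    have hψeq : ψ (quantile ν a) = |quantile μ a - quantile ν a| ^ p - φ (quantile μ a) := by
      refine le_antisymm (hψle _ hYm _) (le_csInf ((nonempty_Icc.2 hM).image _) ?_)
      rintro _ ⟨x, -, rfl⟩
      refine hmin _ _ (fun s hs => ?_) (fun s hs => ?_) x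
      · refine quantile_monotoneOn hS (hcdf s) ha' (le_of_not_ge fun h => ?_)
        exact hs.not_ge ((quantile_le_iff hR ha s).2 h)
      · exact quantile_monotoneOn hS ha' (hcdf s) ((quantile_le_iff hR ha s).1 hs)
    simp only [Function.comp, hπid _ hYm, hπid _ hZm, hψeq]
    ring

/-- For compactly supported Borel probability measures `μ, ν` on
`[0,∞) ⊆ ℝ`, with cumulative distribution functions `u(y) = μ((−∞,y])`,
`v(y) = ν((−∞,y])` and generalized inverses `Y(a) = ∫₀^∞ H(a − u(y)) dy`,
`Z(a) = ∫₀^∞ H(a − v(y)) dy`, one has `δ_p^p(μ,ν) = ∫₀¹ |Y(a) − Z(a)|^p da`. -/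
theorem stmt18 (p : ℝ) (hp : 1 ≤ p) (μ ν : Measure ℝ)
    (hμ : IsProbabilityMeasure μ) (hν : IsProbabilityMeasure ν)
    (hμs : ∃ R : ℝ, μ (Set.Icc (0:ℝ) R) = 1) (hνs : ∃ R : ℝ, ν (Set.Icc (0:ℝ) R) = 1)
    (u v : ℝ → ℝ)
    (hu : ∀ y, u y = (μ (Set.Iic y)).toReal) (hv : ∀ y, v y = (ν (Set.Iic y)).toReal)
    (Y Z : ℝ → ℝ)
    (hY : ∀ a, Y a = ∫ y in Set.Ioi (0:ℝ), Heav (a - u y))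
    (hZ : ∀ a, Z a = ∫ y in Set.Ioi (0:ℝ), Heav (a - v y)) :
    MKdist p μ ν = ∫ a in Set.Icc (0:ℝ) 1, |Y a - Z a| ^ p := by
  obtain ⟨R, hR⟩ := hμs
  obtain ⟨S, hS⟩ := hνs
  obtain rfl : u = cdf μ := funext fun y => by rw [hu, cdf_eq_real, measureReal_def]
  obtain rfl : v = cdf ν := funext fun y => by rw [hv, cdf_eq_real, measureReal_def]
  obtain rfl : Y = quantile μ := funext hY
  obtain rfl : Z = quantile ν := funext hZ
  have hsum : ∀ φ ψ : ℝ → ℝ, Continuous φ → Continuous ψ → (∫ x, φ x ∂μ) + ∫ y, ψ y ∂ν =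
      ∫ a in Ioc (0:ℝ) 1, (φ (quantile μ a) + ψ (quantile ν a)) := fun φ ψ hφ hψ => by
    rw [integral_eq_integral_quantile hR hφ, integral_eq_integral_quantile hS hψ]
    exact (integral_add (integrableOn_comp_quantile hR hS (hφ.comp continuous_fst))
      (integrableOn_comp_quantile hR hS (hψ.comp continuous_snd))).symm
  rw [integral_Icc_eq_integral_Ioc]
  refine IsGreatest.csSup_eq ⟨?_, ?_⟩
  · obtain ⟨φ, ψ, hφ, hψ, hle, heq⟩ := exists_dual_pair hp hR hS
    refine ⟨φ, ψ, hφ, hψ, hle, ?_⟩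
    rw [hsum φ ψ hφ hψ]
    exact (setIntegral_congr_fun measurableSet_Ioc heq).symm
  · rintro _ ⟨φ, ψ, hφ, hψ, hle, rfl⟩
    rw [hsum φ ψ hφ hψ]
    exact integral_mono
      (integrableOn_comp_quantile hR hS ((hφ.comp continuous_fst).add (hψ.comp continuous_snd)))
      (integrableOn_comp_quantile hR hS
        ((continuous_abs_rpow hp).comp (continuous_fst.sub continuous_snd)))
      fun a => hle _ _
end
end
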